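/- Let C be a sliced coloring of ℤ^d with defining slices S_1,…,S_d. If m of these slices have a point in common, then the red sensitivity satisfies s^R(C) ≥ m; that is, the red sensitivity of a sliced coloring is at least the maximum number of defining slices that intersect at one point. -/

import Mathlib

open Function

section Lattice

variable {ι : Type*} [Fintype ι] [DecidableEq ι]

/-- A two-coloring of the lattice `ℤ^ι`: `false` = red, `true` = blue. -/
def sensAt (C : (ι → ℤ) → Bool) (x : ι → ℤ) : ℕ :=
  (Finset.univ.filter fun p : ι × Bool =>
    C (Function.update x p.1 (x p.1 + if p.2 then 1 else -1)) ≠ C x).card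

/-- The axis-sensitivity of `C` at the point `x`: the number of coordinate
directions along which some neighbor of `x` has a different color. -/
def axisSensAt (C : (ι → ℤ) → Bool) (x : ι → ℤ) : ℕ :=
  (Finset.univ.filter fun i : ι =>
    C (Function.update x i (x i + 1)) ≠ C x ∨
      C (Function.update x i (x i - 1)) ≠ C x).card

/-- The sensitivity `s(C)` of a coloring: the maximum of `s(C,x)` over all `x`. -/
noncomputable def sensSup (C : (ι → ℤ) → Bool) : ℕ := sSup (Set.range (sensAt C))

/-- The axis-sensitivity `r(C)` of a coloring: the maximum of `r(C,x)` over all `x`. -/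
noncomputable def axisSensSup (C : (ι → ℤ) → Bool) : ℕ := sSup (Set.range (axisSensAt C))

/-- The red sensitivity `s^R(C)`: maximum axis-sensitivity over red points. -/
noncomputable def redSens (C : (ι → ℤ) → Bool) : ℕ := sSup (axisSensAt C '' {x | C x = false})

/-- The blue sensitivity `s^B(C)`: maximum axis-sensitivity over blue points. -/
noncomputable def blueSens (C : (ι → ℤ) → Bool) : ℕ := sSup (axisSensAt C '' {x | C x = true})

/-- A coloring is non-trivial if the origin is red and each axis carries a blue point. -/
def NontrivialColoring (C : (ι → ℤ) → Bool) : Prop :=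
  C (fun _ => 0) = false ∧
    ∀ i : ι, ∃ m : ℤ, C (Function.update (fun _ => 0) i m) = true

/-- `y` is a neighbor of `x`: they differ by `±1` in exactly one coordinate. -/
def IsNeighbor (x y : ι → ℤ) : Prop :=
  ∃ i : ι, y = Function.update x i (x i + 1) ∨ y = Function.update x i (x i - 1)

/-- `k` is the min-width of `C`: the least positive integer such that on every axis
there is a blue point within distance `k` of the origin. -/
def MinWidth (C : (ι → ℤ) → Bool) (k : ℕ) : Prop :=
  IsLeast {w : ℕ | 0 < w ∧ ∀ i : ι, ∃ m : ℤ, |m| ≤ (w : ℤ) ∧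
    C (Function.update (fun _ => 0) i m) = true} k

end Lattice

section Sliced

/-- The slice of `ℤ^d` with nonzero coordinate `y` fixed to the constant `c`
and the coordinates in `X` fixed to `0`. -/
def sliceSet (d : ℕ) (y : Fin d) (c : ℤ) (X : Set (Fin d)) : Set (Fin d → ℤ) :=
  {x | x y = c ∧ ∀ i ∈ X, x i = 0}

/-- `C` is a sliced coloring with nonzero constants `c i ≥ 3` and zero sets `X i`:
it is non-trivial and its blue points are exactly the union of the `d` slices
`S_i = sliceSet d i (c i) (X i)`, where `S_i` has its nonzero coordinate in dimension `i`. -/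
def IsSlicedColoring (d : ℕ) (C : (Fin d → ℤ) → Bool) (c : Fin d → ℤ)
    (X : Fin d → Set (Fin d)) : Prop :=
  NontrivialColoring C ∧ (∀ i, 3 ≤ c i) ∧ (∀ i, i ∉ X i) ∧
    ∀ x, C x = true ↔ ∃ i : Fin d, x ∈ sliceSet d i (c i) (X i)

end Sliced

/-- The axis-sensitivity at any red point is a lower bound for the red sensitivity. -/
theorem axisSensAt_le_redSens {ι : Type*} [Fintype ι] [DecidableEq ι] {C : (ι → ℤ) → Bool}
    {x : ι → ℤ} (hx : C x = false) : axisSensAt C x ≤ redSens C := by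
  refine le_csSup ⟨Fintype.card ι, ?_⟩ ⟨x, hx, rfl⟩
  rintro _ ⟨y, -, rfl⟩
  exact Finset.card_le_univ _

/-- If `m` of the defining slices of a sliced coloring have a point in
common, then the red sensitivity is at least `m`. -/
theorem sliced_redSens_ge_intersecting (d : ℕ) (C : (Fin d → ℤ) → Bool)
    (c : Fin d → ℤ) (X : Fin d → Set (Fin d)) (h : IsSlicedColoring d C c X)
    (T : Finset (Fin d)) (hT : ∃ p : Fin d → ℤ, ∀ i ∈ T, p ∈ sliceSet d i (c i) (X i)) :
    T.card ≤ redSens C := by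
  obtain ⟨-, hc, -, hC⟩ := h
  obtain ⟨p, hp⟩ := hT
  have zero_set_notMem : ∀ i ∈ T, ∀ j ∈ X i, j ∉ T := by
    intro i hi j hj hjT
    have h0 := (hp i hi).2 j hj
    have h1 := (hp j hjT).1
    have h2 := hc j
    omega
  let x : Fin d → ℤ := fun i => if i ∈ T then c i - 1 else 0
  have x_red : C x = false := by
    rw [Bool.eq_false_iff, Ne, hC]
    rintro ⟨i, hi, -⟩
    have h2 := hc i
    simp only [x] at hi
    split_ifs at hi <;> omega
  refine le_trans (Finset.card_le_card fun i hi => ?_) (axisSensAt_le_redSens x_red)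
  have x_add_blue : C (Function.update x i (x i + 1)) = true := by
    refine (hC _).2 ⟨i, by simp [x, hi], fun j hj => ?_⟩
    have hjT := zero_set_notMem i hi j hj
    have hji : j ≠ i := fun hji => hjT (hji ▸ hi)
    simp [x, hji, hjT]
  simp [x_add_blue, x_red]
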